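/- Let n ∈ ℤ^D \ {0}, ω ∈ ℝ and k ∈ ℝ^D be such that ω ≠ 0 or k·n ∉ 2πℤ. Then for Lebesgue-almost every v ∈ ℝ: lim_{T→∞} (1/T) ∫₀^T e^{i(ω t − k·⌊v t n⌋)} dt = 0, where ⌊v t n⌋ ∈ ℤ^D denotes the componentwise integer part (floor) of v t n ∈ ℝ^D and k·x is the Euclidean inner product. -/

import Mathlib

open MeasureTheory Filter Topology Real

/-- The primitive of a function that is multiplied by a unimodular constant `c ≠ 1` under
translation by `p ≠ 0` is bounded. -/
theorem exists_norm_integral_le_of_quasiperiodic {f : ℝ → ℂ} {p : ℝ} {c : ℂ}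
    (hf : ∀ a b, IntervalIntegrable f volume a b) (hp : p ≠ 0) (hc : ‖c‖ = 1) (hc1 : c ≠ 1)
    (hfp : ∀ t, f (t + p) = c * f t) :
    ∃ C, ∀ T, ‖∫ t in (0 : ℝ)..T, f t‖ ≤ C := by
  set F : ℝ → ℂ := fun T => ∫ t in (0 : ℝ)..T, f t with hF
  have hFp : ∀ T, F (T + p) = F p + c * F T := fun T => by
    have hshift : ∫ t in p..(T + p), f t = c * F T := by
      rw [hF, ← intervalIntegral.integral_const_mul]
      simp_rw [← hfp]
      rw [intervalIntegral.integral_comp_add_right, zero_add]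
    rw [← hshift]
    exact (intervalIntegral.integral_add_adjacent_intervals (hf _ _) (hf _ _)).symm
  have hc' : 1 - c ≠ 0 := sub_ne_zero.mpr hc1.symm
  set a : ℂ := F p / (1 - c) with ha
  have ha' : F p = a * (1 - c) := by rw [ha]; field_simp
  have hcont : Continuous F := intervalIntegral.continuous_primitive hf 0
  have hper : Function.Periodic (fun T => ‖F T - a‖) p := fun T => by
    have h : F (T + p) - a = c * (F T - a) := by rw [hFp, ha']; ring
    simp only [h, norm_mul, hc, one_mul]
  obtain ⟨C, hC⟩ := (hper.isBounded_of_continuous hp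
    (hcont.sub continuous_const).norm).exists_norm_le
  refine ⟨C + ‖a‖, fun T => ?_⟩
  have h1 : ‖F T - a‖ ≤ C := by simpa using hC _ ⟨T, rfl⟩
  have h2 := norm_add_le (F T - a) a
  rw [sub_add_cancel] at h2
  exact h2.trans (by gcongr)

/-- The averages over `[0, T]` of a function with bounded primitive tend to zero. -/
theorem tendsto_average_zero_of_norm_integral_le {f : ℝ → ℂ} {C : ℝ}
    (hC : ∀ T, ‖∫ t in (0 : ℝ)..T, f t‖ ≤ C) :
    Tendsto (fun T : ℝ => (1 / (T : ℂ)) * ∫ t in (0 : ℝ)..T, f t) atTop (𝓝 0) := by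
  refine squeeze_zero_norm' (a := fun T : ℝ => C / T) ?_ (tendsto_id.const_div_atTop C)
  filter_upwards [eventually_gt_atTop 0] with T hT
  rw [norm_mul, norm_div, norm_one, Complex.norm_real, Real.norm_of_nonneg hT.le,
    one_div_mul_eq_div]
  gcongr
  exact hC T

/-- The oscillatory phase along a ray at velocity `v`. -/
noncomputable def rayPhase {D : ℕ} (n : Fin D → ℤ) (ω : ℝ) (k : Fin D → ℝ) (v t : ℝ) : ℝ :=
  ω * t - ∑ i, k i * (⌊v * t * (n i : ℝ)⌋ : ℝ)

theorem rayPhase_add_inv {D : ℕ} (n : Fin D → ℤ) (ω : ℝ) (k : Fin D → ℝ) {v : ℝ} (hv : v ≠ 0)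
    (t : ℝ) :
    rayPhase n ω k v (t + v⁻¹) = (ω / v - ∑ i, k i * (n i : ℝ)) + rayPhase n ω k v t := by
  have hfloor : ∀ i, ⌊v * (t + v⁻¹) * (n i : ℝ)⌋ = ⌊v * t * (n i : ℝ)⌋ + n i := fun i => by
    rw [← Int.floor_add_intCast]
    congr 1
    field_simp
  simp only [rayPhase, hfloor, Int.cast_add, mul_add (k _), Finset.sum_add_distrib]
  ring

theorem measurable_rayPhase {D : ℕ} (n : Fin D → ℤ) (ω : ℝ) (k : Fin D → ℝ) (v : ℝ) :
    Measurable (rayPhase n ω k v) := by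
  unfold rayPhase
  fun_prop

theorem intervalIntegrable_exp_rayPhase {D : ℕ} (n : Fin D → ℤ) (ω : ℝ) (k : Fin D → ℝ)
    (v a b : ℝ) :
    IntervalIntegrable (fun t => Complex.exp (Complex.I * (rayPhase n ω k v t : ℂ)))
      volume a b := by
  have hmeas := measurable_rayPhase n ω k v
  refine (intervalIntegrable_const (c := (1 : ℝ))).mono_fun
    (Measurable.aestronglyMeasurable (by fun_prop)) (.of_forall fun t => ?_)
  simp [Complex.norm_exp]

/-- Outside the resonant velocities the oscillatory ray average vanishes. -/
theorem tendsto_rayAverage {D : ℕ} (n : Fin D → ℤ) (ω : ℝ) (k : Fin D → ℝ) {v : ℝ} (hv : v ≠ 0)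
    (hres : ∀ m : ℤ, ω / v - ∑ i, k i * (n i : ℝ) ≠ m * (2 * π)) :
    Tendsto (fun T : ℝ => (1 / (T : ℂ)) *
      ∫ t in (0 : ℝ)..T, Complex.exp (Complex.I * (rayPhase n ω k v t : ℂ))) atTop (𝓝 0) := by
  set θ : ℝ := ω / v - ∑ i, k i * (n i : ℝ) with hθ
  obtain ⟨C, hC⟩ := exists_norm_integral_le_of_quasiperiodic
    (c := Complex.exp (Complex.I * (θ : ℂ)))
    (intervalIntegrable_exp_rayPhase n ω k v) (inv_ne_zero hv)
    (by simp [Complex.norm_exp])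
    (fun h => by
      obtain ⟨m, hm⟩ := Complex.exp_eq_one_iff.mp h
      refine hres m (Complex.ofReal_injective ?_)
      push_cast
      refine mul_left_cancel₀ Complex.I_ne_zero (hm.trans ?_)
      ring)
    (fun t => by
      rw [rayPhase_add_inv n ω k hv, ← hθ, Complex.ofReal_add, mul_add, Complex.exp_add])
  exact tendsto_average_zero_of_norm_integral_le hC

/-- for every non-resonant pair `(ω, k)` (i.e. `ω ≠ 0` or `k·n ∉ 2πℤ`), the
oscillatory one-point ray average `(1/T) ∫₀^T e^{i(ω t − k·⌊v t n⌋)} dt` vanishes as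
`T → ∞`, for Lebesgue-almost every velocity `v`. -/
theorem stmt_18 {D : ℕ} (n : Fin D → ℤ) (hn : n ≠ 0) (ω : ℝ) (k : Fin D → ℝ)
    (hnres : ω ≠ 0 ∨ ¬∃ m : ℤ, ∑ i, k i * (n i : ℝ) = 2 * π * m) :
    ∀ᵐ v : ℝ ∂volume,
      Tendsto (fun T : ℝ => (1 / (T : ℂ)) *
          ∫ t in (0:ℝ)..T,
            Complex.exp (Complex.I * ((ω * t : ℝ) - ∑ i, k i * (⌊v * t * (n i : ℝ)⌋ : ℝ))))
        atTop (𝓝 0) := by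
  have hcount : (insert 0 (Set.range fun m : ℤ =>
      ω / (∑ i, k i * (n i : ℝ) + m * (2 * π)))).Countable :=
    (Set.countable_range _).insert 0
  filter_upwards [hcount.ae_notMem volume] with v hv
  rw [Set.mem_insert_iff, not_or] at hv
  obtain ⟨hv0, hv⟩ := hv
  have h := tendsto_rayAverage n ω k hv0 fun m hm => by
    have hω : ω = v * (∑ i, k i * (n i : ℝ) + m * (2 * π)) := by
      rw [← hm]; field_simp; ring
    by_cases hs : ∑ i, k i * (n i : ℝ) + m * (2 * π) = 0
    · rw [hs, mul_zero] at hω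
      refine hnres.elim (· hω) (· ⟨-m, ?_⟩)
      push_cast
      linarith
    · exact hv ⟨m, (div_eq_iff hs).mpr hω⟩
  simpa [rayPhase] using h
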